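/- Every finite lower bounded lattice L embeds into the lattice Co(ℝ^n, X) for some n ∈ ℕ and some finite set X ⊆ ℝ^n such that Co(ℝ^n, X) is itself lower bounded; moreover L also embeds into the lattice Co(ℝ^n) of all convex subsets of ℝ^n. -/

import Mathlib

/-- `Y` is a relatively convex subset of `X`: `Y = conv(Y) ∩ X`. -/
def relConvex {n : ℕ} (X Y : Set (EuclideanSpace ℝ (Fin n))) : Prop :=
  Y = convexHull ℝ Y ∩ X

/-- The join in the lattice `Co(ℝ^n, X)`: `A ∨ B = conv(A ∪ B) ∩ X`. -/
def coJoin {n : ℕ} (X A B : Set (EuclideanSpace ℝ (Fin n))) : Set (EuclideanSpace ℝ (Fin n)) :=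
  convexHull ℝ (A ∪ B) ∩ X

/-- A join-irreducible element of the lattice `Co(ℝ^n, X)`. -/
def SupIrredCo {n : ℕ} (X A : Set (EuclideanSpace ℝ (Fin n))) : Prop :=
  relConvex X A ∧ A ≠ ∅ ∧
    ∀ B C, relConvex X B → relConvex X C → coJoin X B C = A → B = A ∨ C = A

/-- The join-dependency relation `D` on join-irreducible elements of `Co(ℝ^n, X)`. -/
def DRelCo {n : ℕ} (X A B : Set (EuclideanSpace ℝ (Fin n))) : Prop :=
  SupIrredCo X A ∧ SupIrredCo X B ∧ A ≠ B ∧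
    ∃ P, relConvex X P ∧ A ⊆ coJoin X B P ∧
      ∀ C, relConvex X C → C ⊂ B → ¬ A ⊆ coJoin X C P

/-- `Co(ℝ^n, X)` has no `D`-cycle among its join-irreducible elements; for a finite
lattice this is equivalent to lower boundedness. -/
def NoDCycleCo {n : ℕ} (X : Set (EuclideanSpace ℝ (Fin n))) : Prop :=
  ¬ ∃ (m : ℕ) (f : ℕ → Set (EuclideanSpace ℝ (Fin n))), 2 ≤ m ∧
      ∀ i < m, DRelCo X (f i) (f ((i + 1) % m))

/-- The join-dependency relation `D` in an abstract lattice: `a D b` iff `a ≠ b` and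
there is `p` with `a ≤ b ⊔ p` but `a ≰ c ⊔ p` for all `c < b`. -/
def DRelL {L : Type*} [Lattice L] (a b : L) : Prop :=
  a ≠ b ∧ ∃ p, a ≤ b ⊔ p ∧ ∀ c < b, ¬ a ≤ c ⊔ p

/-- A finite lattice is lower bounded iff it has no `D`-cycle among its
join-irreducible elements. -/
def LowerBoundedLattice (L : Type*) [Lattice L] : Prop :=
  ¬ ∃ (m : ℕ) (f : ℕ → L), 2 ≤ m ∧ (∀ i < m, SupIrred (f i)) ∧
      ∀ i < m, DRelL (f i) (f ((i + 1) % m))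

namespace FLB

open Finset

set_option linter.unusedSectionVars false

section Core
variable {T B : Type*} [Fintype T] [Fintype B] [DecidableEq T]

def rel (top : B → T) (blk : B → Finset T) (b : B) : T → ℝ :=
  ∑ t ∈ blk b, (Pi.single t 1 - Pi.single (top b) 1)

def simpS (S : Set T) : Set (T → ℝ) :=
  {c | (∀ t, 0 ≤ c t) ∧ ∑ t, c t = 1 ∧ ∀ t, t ∉ S → c t = 0}

def Canon (blk : B → Finset T) (c : T → ℝ) : Prop :=
  (∀ t, 0 ≤ c t) ∧ ∀ b, ∃ t ∈ blk b, c t = 0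

theorem rel_apply (top : B → T) (blk : B → Finset T) (b : B) (s : T) :
    rel top blk b s = (if s ∈ blk b then 1 else 0)
      - (if s = top b then ((blk b).card : ℝ) else 0) := by
  simp only [rel, Finset.sum_apply, Pi.sub_apply, Pi.single_apply, Finset.sum_sub_distrib]
  congr 1
  · simp
  · simp

theorem rel_dot (top : B → T) (blk : B → Finset T) (b : B) (w : T → ℝ) :
    ∑ s, rel top blk b s * w s = ∑ t ∈ blk b, (w t - w (top b)) := by
  simp only [rel, Finset.sum_apply, Pi.sub_apply, Finset.sum_mul]
  rw [Finset.sum_comm]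
  refine Finset.sum_congr rfl fun t _ => ?_
  simp [Pi.single_apply, sub_mul, Finset.sum_sub_distrib]

theorem canon_unique (top : B → T) (blk : B → Finset T) (rk : T → ℕ)
    (h1 : ∀ t b b', t ∈ blk b → t ∈ blk b' → b = b')
    (h2 : ∀ b, ∀ t ∈ blk b, rk (top b) < rk t)
    (c c' : T → ℝ) (hc : Canon blk c) (hc' : Canon blk c')
    (hd : c - c' ∈ Submodule.span ℝ (Set.range (rel top blk))) : c = c' := by
  obtain ⟨μ, hμ⟩ := (Submodule.mem_span_range_iff_exists_fun ℝ).1 hd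
  have hz : ∀ b, μ b = 0 := by
    obtain ⟨N, hN⟩ : ∃ N, ∀ t, rk t ≤ N :=
      ⟨univ.sup rk, fun t => Finset.le_sup (Finset.mem_univ t)⟩
    have key : ∀ k, ∀ b, N - rk (top b) = k → μ b = 0 := by
      intro k
      induction k using Nat.strong_induction_on with
      | _ k ih =>
        intro b hb
        have hv : ∀ t ∈ blk b, c t - c' t = μ b := by
          intro t ht
          have h3 := congrFun hμ t
          rw [Finset.sum_apply, Pi.sub_apply] at h3
          rw [← h3, Finset.sum_eq_single b]
          · have : t ≠ top b := fun h => by have := h2 b t ht; rw [← h] at this; omega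
            simp [rel_apply, ht, this]
          · intro b' _ hb'
            have hn : t ∉ blk b' := fun h => hb' (h1 t b' b h ht)
            by_cases htop : t = top b'
            · have : μ b' = 0 := by
                refine ih (N - rk (top b')) ?_ b' rfl
                have := h2 b t ht
                have := hN t
                rw [← htop]; omega
              simp [this]
            · simp [rel_apply, hn, htop]
          · simp
        obtain ⟨t, ht, ht0⟩ := hc.2 b
        obtain ⟨s, hs, hs0⟩ := hc'.2 b
        have := hv t ht
        have := hv s hs
        have := hc.1 s
        have := hc'.1 t
        linarith
    exact fun b => key _ b rfl
  have : c - c' = 0 := by rw [← hμ]; simp [hz]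
  exact sub_eq_zero.1 this

def Closed (top : B → T) (blk : B → Finset T) (S : Set T) : Prop :=
  ∀ b, (∀ t ∈ blk b, t ∈ S) → top b ∈ S

theorem isCompact_simp (S : Set T) : IsCompact (simpS S) := by
  have : simpS S = stdSimplex ℝ T ∩ {c | ∀ t, t ∉ S → c t = 0} := by
    ext c; simp [simpS, stdSimplex, and_assoc]
  rw [this]
  refine (isCompact_stdSimplex ℝ T).inter_right ?_
  simp only [Set.ofPred_forall]
  exact isClosed_iInter fun t => isClosed_iInter fun _ =>
    isClosed_eq (continuous_apply t) continuous_const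

theorem canon_exists (top : B → T) (blk : B → Finset T) (rk : T → ℕ)
    (h2 : ∀ b, ∀ t ∈ blk b, rk (top b) < rk t)
    (h3 : ∀ b, (blk b).Nontrivial)
    {n : ℕ} (π : (T → ℝ) →ₗ[ℝ] EuclideanSpace ℝ (Fin n))
    (hπ : ∀ b, π (rel top blk b) = 0)
    (S : Set T) (hS : Closed top blk S) (c : T → ℝ) (hc : c ∈ simpS S) :
    ∃ d ∈ simpS S, Canon blk d ∧ π d = π c := by
  have hcont : Continuous π := π.continuous_of_finiteDimensional
  have hK : IsCompact (simpS S ∩ {d | π d = π c}) :=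
    (isCompact_simp S).inter_right (isClosed_eq hcont continuous_const)
  obtain ⟨d, ⟨hd, hdπ⟩, hmin⟩ := hK.exists_isMinOn ⟨c, hc, rfl⟩
    (f := fun d => ∑ t, d t * (rk t : ℝ)) (by fun_prop)
  refine ⟨d, hd, ⟨hd.1, ?_⟩, hdπ⟩
  by_contra! hcon
  obtain ⟨b, hb⟩ := hcon
  obtain ⟨t0, ht0, hle⟩ := Finset.exists_min_image (blk b) d (h3 b).nonempty
  set ε := d t0 with hε
  have hεpos : 0 < ε := lt_of_le_of_ne (hd.1 t0) (Ne.symm (hb t0 ht0))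
  have hblkS : ∀ t ∈ blk b, t ∈ S := by
    intro t ht
    by_contra hn
    exact hb t ht (hd.2.2 t hn)
  have htop := hS b hblkS
  have htb : top b ∉ blk b := fun h => lt_irrefl _ (h2 b _ h)
  have hmem : d - ε • rel top blk b ∈ simpS S ∩ {d | π d = π c} := by
    refine ⟨⟨?_, ?_, ?_⟩, ?_⟩
    · intro t
      simp only [Pi.sub_apply, Pi.smul_apply, rel_apply, smul_eq_mul]
      have := hd.1 t
      by_cases ht : t ∈ blk b
      · have h5 : t ≠ top b := fun h => htb (h ▸ ht)
        have := hle t ht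
        simp [ht, h5]; exact this
      · by_cases h5 : t = top b
        · subst h5
          simp [ht]; positivity
        · simp [ht, h5, this]
    · have := rel_dot top blk b (fun _ => 1)
      simp only [mul_one, sub_self, Finset.sum_const_zero] at this
      simp [Finset.sum_sub_distrib, ← Finset.mul_sum, this, hd.2.1]
    · intro t ht
      have h6 : t ∉ blk b := fun h => ht (hblkS t h)
      have h5 : t ≠ top b := fun h => ht (h ▸ htop)
      simp [rel_apply, h6, h5, hd.2.2 t ht]
    · have : π d = π c := hdπ
      simp [hπ, this]
  have h7 : (∑ t, d t * (rk t : ℝ)) ≤ ∑ t, (d - ε • rel top blk b) t * (rk t : ℝ) := hmin hmem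
  have h8 : ∑ t, (d - ε • rel top blk b) t * (rk t : ℝ)
      = (∑ t, d t * (rk t : ℝ)) - ε * ∑ t ∈ blk b, ((rk t : ℝ) - rk (top b)) := by
    rw [← rel_dot top blk b (fun t => (rk t : ℝ)), Finset.mul_sum, ← Finset.sum_sub_distrib]
    refine Finset.sum_congr rfl fun t _ => ?_
    simp only [Pi.sub_apply, Pi.smul_apply, smul_eq_mul]; ring
  have h9 : 0 < ∑ t ∈ blk b, ((rk t : ℝ) - rk (top b)) := by
    refine Finset.sum_pos (fun t ht => ?_) (h3 b).nonempty
    have : (rk (top b) : ℝ) < rk t := by exact_mod_cast h2 b t ht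
    linarith
  have := mul_pos hεpos h9
  linarith

theorem hull_simp (S : Set T) :
    convexHull ℝ ((fun t => (Pi.single t 1 : T → ℝ)) '' S) = simpS S := by
  apply subset_antisymm
  · apply convexHull_min
    · rintro _ ⟨t, ht, rfl⟩
      refine ⟨fun s => ?_, by simp, fun s hs => ?_⟩
      · simp only [Pi.single_apply]; split_ifs <;> norm_num
      · have : s ≠ t := fun h => hs (h ▸ ht)
        simp [this]
    · intro c hc d hd a b ha hb hab
      refine ⟨fun t => ?_, ?_, fun t ht => ?_⟩
      · have := hc.1 t; have := hd.1 t
        simp only [Pi.add_apply, Pi.smul_apply, smul_eq_mul]; positivity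
      · simp [Finset.sum_add_distrib, ← Finset.mul_sum, hc.2.1, hd.2.1, hab]
      · simp [hc.2.2 t ht, hd.2.2 t ht]
  · intro c hc
    classical
    have hsum : c = ∑ t ∈ univ.filter (· ∈ S), c t • (Pi.single t 1 : T → ℝ) := by
      rw [Finset.sum_filter]
      ext s
      simp only [Finset.sum_apply]
      rw [Finset.sum_eq_single s]
      · by_cases hs : s ∈ S
        · simp [hs]
        · simp [hs, hc.2.2 s hs]
      · intro t _ hts
        split_ifs
        · simp [hts.symm]
        · rfl
      · simp
    rw [hsum]
    refine (convex_convexHull ℝ _).sum_mem (fun t _ => hc.1 t) ?_ ?_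
    · rw [Finset.sum_filter, ← hc.2.1]
      refine Finset.sum_congr rfl fun t _ => ?_
      split_ifs with h
      · rfl
      · exact (hc.2.2 t h).symm
    · intro t ht
      exact subset_convexHull ℝ _ ⟨t, (Finset.mem_filter.1 ht).2, rfl⟩

theorem core (top : B → T) (blk : B → Finset T) (rk : T → ℕ)
    (h1 : ∀ t b b', t ∈ blk b → t ∈ blk b' → b = b')
    (h2 : ∀ b, ∀ t ∈ blk b, rk (top b) < rk t)
    (h3 : ∀ b, (blk b).Nontrivial) :
    ∃ (n : ℕ) (pt : T → EuclideanSpace ℝ (Fin n)), Function.Injective pt ∧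
      (∀ b, pt (top b) ∈ convexHull ℝ (pt '' (blk b : Set T))) ∧
      (∀ S t, Closed top blk S → pt t ∈ convexHull ℝ (pt '' S) → t ∈ S) ∧
      (∀ S S', Closed top blk S → Closed top blk S' →
        convexHull ℝ (pt '' S) ∩ convexHull ℝ (pt '' S') ⊆ convexHull ℝ (pt '' (S ∩ S'))) := by
  set W : Submodule ℝ (T → ℝ) := Submodule.span ℝ (Set.range (rel top blk)) with hW
  let e : ((T → ℝ) ⧸ W) ≃ₗ[ℝ] EuclideanSpace ℝ (Fin (Module.finrank ℝ ((T → ℝ) ⧸ W))) :=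
    LinearEquiv.ofFinrankEq _ _ (by simp)
  let π := e.toLinearMap ∘ₗ W.mkQ
  have hker : ∀ c d, π c = π d → c - d ∈ W := by
    intro c d h
    have : W.mkQ c = W.mkQ d := e.injective h
    exact (Submodule.Quotient.eq W).1 this
  have hπ : ∀ b, π (rel top blk b) = 0 := by
    intro b
    have : W.mkQ (rel top blk b) = 0 := by
      rw [Submodule.mkQ_apply, Submodule.Quotient.mk_eq_zero]
      exact Submodule.subset_span ⟨b, rfl⟩
    simp only [π, LinearMap.comp_apply, this, map_zero]
  have hull : ∀ S : Set T, convexHull ℝ ((fun t => π (Pi.single t 1)) '' S) = π '' simpS S := by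
    intro S
    rw [← hull_simp, LinearMap.image_convexHull, Set.image_image]
  have hsingle : ∀ t, Canon blk (Pi.single t 1 : T → ℝ) := by
    intro t
    refine ⟨fun s => ?_, fun b => ?_⟩
    · simp only [Pi.single_apply]; split_ifs <;> norm_num
    · obtain ⟨s, hs, hne⟩ := (h3 b).exists_ne t
      exact ⟨s, hs, by simp [hne]⟩
  have huniq : ∀ c d, Canon blk c → Canon blk d → π c = π d → c = d := fun c d hc hd h =>
    canon_unique top blk rk h1 h2 c d hc hd (hker c d h)
  refine ⟨_, fun t => π (Pi.single t 1), ?_, ?_, ?_, ?_⟩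
  · intro s t h
    have := congrFun (huniq _ _ (hsingle s) (hsingle t) h) s
    by_contra hne
    simp [hne] at this
  · intro b
    have hk : (0 : ℝ) < (blk b).card := by exact_mod_cast (h3 b).nonempty.card_pos
    have h := hπ b
    simp only [rel, map_sum, map_sub, Finset.sum_sub_distrib, Finset.sum_const] at h
    have h4 : π (Pi.single (top b) 1)
        = ∑ t ∈ blk b, ((blk b).card : ℝ)⁻¹ • π (Pi.single t 1) := by
      rw [← Finset.smul_sum, sub_eq_zero.1 h, ← Nat.cast_smul_eq_nsmul ℝ, map_smul, smul_smul,
        inv_mul_cancel₀ hk.ne', one_smul]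
    show π (Pi.single (top b) 1) ∈ _
    rw [h4]
    refine (convex_convexHull ℝ _).sum_mem (fun t _ => by positivity) ?_ ?_
    · rw [Finset.sum_const, nsmul_eq_mul, mul_inv_cancel₀ hk.ne']
    · intro t ht
      exact subset_convexHull ℝ _ ⟨t, ht, rfl⟩
  · intro S t hS ht
    rw [hull] at ht
    obtain ⟨c, hc, hct⟩ := ht
    obtain ⟨d, hd, hdc, hdπ⟩ := canon_exists top blk rk h2 h3 π hπ S hS c hc
    have : d = Pi.single t 1 := huniq _ _ hdc (hsingle t) (hdπ.trans hct)
    by_contra hn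
    have := hd.2.2 t hn
    simp_all
  · intro S S' hS hS'
    rw [hull, hull, hull]
    rintro z ⟨⟨c, hc, hcz⟩, ⟨c', hc', hcz'⟩⟩
    obtain ⟨d, hd, hdc, hdπ⟩ := canon_exists top blk rk h2 h3 π hπ S hS c hc
    obtain ⟨d', hd', hdc', hdπ'⟩ := canon_exists top blk rk h2 h3 π hπ S' hS' c' hc'
    have : d = d' := huniq _ _ hdc hdc' (by rw [hdπ, hdπ', hcz, hcz'])
    subst this
    refine ⟨d, ⟨hd.1, hd.2.1, fun t ht => ?_⟩, hdπ.trans hcz⟩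
    by_cases h : t ∈ S
    · exact hd'.2.2 t fun h' => ht ⟨h, h'⟩
    · exact hd.2.2 t h

end Core

section Geo
variable {T B : Type*} [Fintype T]

theorem noCycle (top : B → T) (blk : B → Finset T) (rk : T → ℕ)
    (h2 : ∀ b, ∀ t ∈ blk b, rk (top b) < rk t)
    (h3 : ∀ b, (blk b).Nontrivial)
    {n : ℕ} (pt : T → EuclideanSpace ℝ (Fin n)) (hinj : Function.Injective pt)
    (hblk : ∀ b, pt (top b) ∈ convexHull ℝ (pt '' (blk b : Set T)))
    (hcl : ∀ S t, Closed top blk S → pt t ∈ convexHull ℝ (pt '' S) → t ∈ S) :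
    NoDCycleCo (Set.range pt) := by
  have relC : ∀ S, Closed top blk S → relConvex (Set.range pt) (pt '' S) := by
    intro S hS
    apply subset_antisymm
    · exact Set.subset_inter (subset_convexHull ℝ _) (Set.image_subset_range _ _)
    · rintro _ ⟨h, t, rfl⟩
      exact ⟨t, hcl S t hS h, rfl⟩
  have relD : ∀ A, relConvex (Set.range pt) A →
      Closed top blk (pt ⁻¹' A) ∧ pt '' (pt ⁻¹' A) = A := by
    intro A hA
    have hsub : A ⊆ Set.range pt := by
      rw [relConvex] at hA; rw [hA]; exact Set.inter_subset_right
    refine ⟨fun b hb => ?_, Set.image_preimage_eq_of_subset hsub⟩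
    show pt (top b) ∈ A
    rw [relConvex] at hA
    rw [hA]
    refine ⟨convexHull_mono ?_ (hblk b), _, rfl⟩
    rintro _ ⟨t, ht, rfl⟩
    exact hb t ht
  have clsing : ∀ t, Closed top blk {t} := by
    intro t b hb
    obtain ⟨s, hs, hne⟩ := (h3 b).exists_ne t
    exact absurd (hb s hs) hne
  have sing : ∀ A, SupIrredCo (Set.range pt) A → ∃ t, A = {pt t} := by
    intro A ⟨hA, hne, hirr⟩
    obtain ⟨hc, hA'⟩ := relD A hA
    have hne' : (pt ⁻¹' A).Nonempty := by
      rw [Set.nonempty_iff_ne_empty]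
      intro h; rw [h] at hA'; simp at hA'; exact hne hA'.symm
    obtain ⟨t, ht, hmax⟩ := Set.exists_max_image (pt ⁻¹' A) rk (Set.toFinite _) hne'
    have ht' : pt t ∈ A := ht
    have hc' : Closed top blk (pt ⁻¹' A \ {t}) := by
      intro b hb
      refine ⟨hc b fun s hs => (hb s hs).1, fun h => ?_⟩
      obtain ⟨s, hs⟩ := (h3 b).nonempty
      have hlt := h2 b s hs
      have hle := hmax s (hb s hs).1
      rw [Set.mem_singleton_iff] at h
      rw [h] at hlt
      omega
    have e1 : pt '' {t} = {pt t} := Set.image_singleton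
    have e2 : pt '' (pt ⁻¹' A \ {t}) = A \ {pt t} := by
      rw [Set.image_sdiff hinj, hA', e1]
    have r1 := relC _ (clsing t)
    have r2 := relC _ hc'
    rw [e1] at r1
    rw [e2] at r2
    rcases hirr {pt t} (A \ {pt t}) r1 r2 (by
      rw [coJoin, Set.union_sdiff_cancel (Set.singleton_subset_iff.2 ht')]
      exact hA.symm) with h | h
    · exact ⟨t, h.symm⟩
    · rw [← h] at ht'; exact absurd rfl ht'.2
  have step : ∀ p q, DRelCo (Set.range pt) {pt p} {pt q} → rk p < rk q := by
    rintro p q ⟨_, _, hne, P, hP, hsub, hmin⟩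
    obtain ⟨hc, hP'⟩ := relD P hP
    have hpq : p ≠ q := fun h => hne (by rw [h])
    have hpP : p ∉ pt ⁻¹' P := by
      intro h
      refine hmin ∅ (by simp [relConvex]) ?_ ?_
      · rw [Set.empty_ssubset]; exact Set.singleton_nonempty _
      · rw [Set.singleton_subset_iff]
        exact ⟨subset_convexHull ℝ _ (Or.inr h), p, rfl⟩
    have hS : Closed top blk (pt ⁻¹' P ∪ {q} ∪ {t | rk t < rk q}) := by
      intro b hb
      by_cases hall : ∀ t ∈ blk b, t ∈ pt ⁻¹' P
      · exact Or.inl (Or.inl (hc b hall))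
      · push Not at hall
        obtain ⟨t, ht, htP⟩ := hall
        right
        have hlt := h2 b t ht
        show rk (top b) < rk q
        rcases hb t ht with (h | h) | h
        · exact absurd h htP
        · rw [Set.mem_singleton_iff] at h; rw [← h]; exact hlt
        · exact hlt.trans h
    have hp := (Set.singleton_subset_iff.1 hsub).1
    have hp' : p ∈ (pt ⁻¹' P ∪ {q} ∪ {t | rk t < rk q}) := by
      refine hcl _ p hS (convexHull_mono ?_ hp)
      rintro z (hz | hz)
      · exact ⟨q, Or.inl (Or.inr rfl), hz.symm⟩
      · rw [← hP'] at hz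
        obtain ⟨t, ht, rfl⟩ := hz
        exact ⟨t, Or.inl (Or.inl ht), rfl⟩
    rcases hp' with (h | h) | h
    · exact absurd h hpP
    · exact absurd h hpq
    · exact h
  rintro ⟨m, f, hm, hf⟩
  have hex : ∀ i, ∃ t, i < m → f i = {pt t} := by
    intro i
    by_cases h : i < m
    · obtain ⟨t, ht⟩ := sing _ (hf i h).1
      exact ⟨t, fun _ => ht⟩
    · obtain ⟨t, ht⟩ := sing _ (hf 0 (by omega)).1
      exact ⟨t, fun h' => absurd h' h⟩
  choose p hp using hex
  obtain ⟨i, hi, hmax⟩ := Finset.exists_max_image (Finset.range m) (fun i => rk (p i))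
    ⟨0, Finset.mem_range.2 (by omega)⟩
  have hi' := Finset.mem_range.1 hi
  have hj : (i + 1) % m < m := Nat.mod_lt _ (by omega)
  have h := hf i hi'
  rw [hp i hi', hp _ hj] at h
  have := step _ _ h
  have := hmax _ (Finset.mem_range.2 hj)
  omega

end Geo

section Lat
variable {L : Type*} [Lattice L] [Fintype L]

theorem cover (a x y : L) (ha : SupIrred a) (hxy : a ≤ x ⊔ y) (hx : ¬ a ≤ x) (hy : ¬ a ≤ y) :
    ∃ E : Finset L, (∀ e ∈ E, SupIrred e ∧ DRelL a e ∧ (e ≤ x ∨ e ≤ y)) ∧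
      (∀ u, (∀ e ∈ E, e ≤ u) → a ≤ u) ∧ E.Nontrivial := by
  classical
  haveI : Nonempty L := ⟨a⟩
  letI : OrderBot L := Fintype.toOrderBot L
  have below : ∀ u v : L, (∀ e, SupIrred e → e ≤ u → e ≤ v) → u ≤ v := by
    intro u v h
    obtain ⟨s, hs, hs'⟩ := exists_supIrred_decomposition u
    rw [← hs]
    refine Finset.sup_le fun e he => h e (hs' he) ?_
    rw [← hs]; exact Finset.le_sup (f := id) he
  let Fam : Finset L → Prop := fun U =>
    (∀ e ∈ U, SupIrred e ∧ (e ≤ x ∨ e ≤ y)) ∧ (∀ e ∈ U, ∀ e', SupIrred e' → e' ≤ e → e' ∈ U) ∧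
      a ≤ U.sup id
  obtain ⟨U, hU, hUmin⟩ := WellFounded.has_min (wellFounded_lt (α := Finset L)) {U | Fam U}
    ⟨Finset.univ.filter (fun e => SupIrred e ∧ (e ≤ x ∨ e ≤ y)), by
      refine ⟨fun e he => (Finset.mem_filter.1 he).2, ?_, ?_⟩
      · intro e he e' he' hle
        have := (Finset.mem_filter.1 he).2
        exact Finset.mem_filter.2 ⟨Finset.mem_univ _, he', this.2.imp hle.trans hle.trans⟩
      · refine hxy.trans (sup_le ?_ ?_)
        · refine below _ _ fun e he hle => ?_
          exact Finset.le_sup (f := id) (Finset.mem_filter.2 ⟨Finset.mem_univ _, he, Or.inl hle⟩)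
        · refine below _ _ fun e he hle => ?_
          exact Finset.le_sup (f := id) (Finset.mem_filter.2 ⟨Finset.mem_univ _, he, Or.inr hle⟩)⟩
  obtain ⟨hU1, hU2, hU3⟩ := hU
  let E := U.filter (fun e => ∀ e' ∈ U, e ≤ e' → e' = e)
  have hEU : ∀ u ∈ U, ∃ e ∈ E, u ≤ e := by
    intro u hu
    obtain ⟨m, hum, hm⟩ := U.exists_le_maximal hu
    exact ⟨m, Finset.mem_filter.2 ⟨hm.prop, fun e' he' hle => le_antisymm (hm.le_of_ge he' hle) hle⟩,
      hum⟩
  have hEle : ∀ u, (∀ e ∈ E, e ≤ u) → a ≤ u := by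
    intro u hu
    refine hU3.trans (Finset.sup_le fun v hv => ?_)
    obtain ⟨e, he, hle⟩ := hEU v hv
    exact hle.trans (hu e he)
  refine ⟨E, ?_, hEle, ?_⟩
  · intro e he
    obtain ⟨heU, hemax⟩ := Finset.mem_filter.1 he
    obtain ⟨hei, hexy⟩ := hU1 e heU
    refine ⟨hei, ⟨?_, (U.erase e).sup id, ?_, ?_⟩, hexy⟩
    · rintro rfl
      exact hexy.elim hx hy
    · refine hU3.trans (Finset.sup_le fun v hv => ?_)
      by_cases h : v = e
      · rw [h]; exact le_sup_left
      · exact le_sup_of_le_right (Finset.le_sup (f := id) (Finset.mem_erase.2 ⟨h, hv⟩))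
    · intro c hc hle
      have hcp : c ≤ (U.erase e).sup id := by
        refine below _ _ fun v hv hvc => ?_
        refine Finset.le_sup (f := id) (Finset.mem_erase.2 ⟨?_, hU2 e heU v hv (hvc.trans hc.le)⟩)
        exact (lt_of_le_of_lt hvc hc).ne
      rw [sup_eq_right.2 hcp] at hle
      refine hUmin (U.erase e) ⟨fun v hv => hU1 v (Finset.mem_of_mem_erase hv), ?_, hle⟩
        (Finset.erase_ssubset heU)
      intro v hv v' hv' hvv
      have hvU := Finset.mem_of_mem_erase hv
      refine Finset.mem_erase.2 ⟨?_, hU2 v hvU v' hv' hvv⟩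
      rintro rfl
      exact Finset.ne_of_mem_erase hv (hemax v hvU hvv)
  · rw [← Finset.one_lt_card_iff_nontrivial]
    by_contra hcard
    have hxy' : ∀ e ∈ E, e ≤ x ∨ e ≤ y := fun e he => (hU1 e (Finset.mem_filter.1 he).1).2
    rcases Finset.card_le_one_iff_subset_singleton.1 (not_lt.1 hcard) with ⟨e, he⟩
    by_cases heE : e ∈ E
    · rcases hxy' e heE with h | h
      · exact hx (hEle x fun v hv => by rw [Finset.mem_singleton.1 (he hv)]; exact h)
      · exact hy (hEle y fun v hv => by rw [Finset.mem_singleton.1 (he hv)]; exact h)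
    · refine hx (hEle x fun v hv => ?_)
      have := Finset.mem_singleton.1 (he hv)
      exact absurd (this ▸ hv) heE

/-- the dependency relation on irreducibles -/
def DJ (a b : L) : Prop := SupIrred a ∧ SupIrred b ∧ DRelL a b

theorem path {a b : L} (h : Relation.TransGen DJ a b) :
    ∃ (m : ℕ) (f : ℕ → L), 1 ≤ m ∧ f 0 = a ∧ f m = b ∧ ∀ i < m, DJ (f i) (f (i + 1)) := by
  induction h with
  | single h =>
    rename_i b
    exact ⟨1, fun i => if i = 0 then a else b, le_rfl, by simp, by simp, fun i hi => by
      have : i = 0 := by omega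
      subst this; simpa using h⟩
  | tail h0 h ih =>
    rename_i b c
    obtain ⟨m, f, hm, h0, hfm, hf⟩ := ih
    refine ⟨m + 1, fun i => if i ≤ m then f i else c, by omega, by simp [h0], by simp, ?_⟩
    intro i hi
    rcases Nat.lt_succ_iff_lt_or_eq.1 hi with h' | h'
    · have e1 : i ≤ m := h'.le
      have e2 : i + 1 ≤ m := h'
      simpa [e1, e2] using hf i h'
    · subst h'; simpa [hfm] using h

theorem height (hL : LowerBoundedLattice L) : ∃ h : L → ℕ, ∀ a b, DJ a b → h b < h a := by
  classical
  have irr : ∀ a : L, ¬ Relation.TransGen DJ a a := by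
    intro a h
    obtain ⟨m, f, hm, h0, hfm, hf⟩ := path h
    apply hL
    have hm2 : 2 ≤ m := by
      by_contra hlt
      have : m = 1 := by omega
      subst this
      have := hf 0 (by omega)
      simp only [zero_add, h0, hfm] at this
      exact this.2.2.1 rfl
    refine ⟨m, f, hm2, fun i hi => (hf i hi).1, fun i hi => ?_⟩
    have := (hf i hi).2.2
    by_cases hi' : i + 1 = m
    · rw [hi', Nat.mod_self, h0]; rw [hi', hfm] at this; exact this
    · rw [Nat.mod_eq_of_lt (by omega)]; exact this
  refine ⟨fun a => (Finset.univ.filter fun b => Relation.TransGen DJ a b).card, fun a b hab => ?_⟩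
  apply Finset.card_lt_card
  refine Finset.ssubset_iff_of_subset ?_ |>.2 ⟨b, ?_, ?_⟩
  · intro c hc
    have := (Finset.mem_filter.1 hc).2
    exact Finset.mem_filter.2 ⟨Finset.mem_univ _, Relation.TransGen.head hab this⟩
  · exact Finset.mem_filter.2 ⟨Finset.mem_univ _, Relation.TransGen.single hab⟩
  · intro h
    exact irr b (Finset.mem_filter.1 h).2

end Lat

end FLB

/-- Every finite lower bounded lattice `L` embeds into `Co(ℝ^n, X)` for some `n` and some
finite `X ⊆ ℝ^n` such that `Co(ℝ^n, X)` is itself lower bounded; moreover `L` also embeds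
into the lattice `Co(ℝ^n)` of all convex subsets of `ℝ^n`. -/
theorem finite_lower_bounded_embeds (L : Type*) [Lattice L] [Fintype L]
    (hL : LowerBoundedLattice L) :
    ∃ (n : ℕ) (X : Set (EuclideanSpace ℝ (Fin n))), X.Finite ∧ NoDCycleCo X ∧
      (∃ f : L → Set (EuclideanSpace ℝ (Fin n)), Function.Injective f ∧
        (∀ a, relConvex X (f a)) ∧
        (∀ a b, f (a ⊓ b) = f a ∩ f b) ∧
        (∀ a b, f (a ⊔ b) = coJoin X (f a) (f b))) ∧
      (∃ g : L → Set (EuclideanSpace ℝ (Fin n)), Function.Injective g ∧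
        (∀ a, Convex ℝ (g a)) ∧
        (∀ a b, g (a ⊓ b) = g a ∩ g b) ∧
        (∀ a b, g (a ⊔ b) = convexHull ℝ (g a ∪ g b))) := by

  classical
  have hcov : ∀ a x y : L, ∃ E : Finset L, (SupIrred a ∧ a ≤ x ⊔ y ∧ ¬ a ≤ x ∧ ¬ a ≤ y) →
      (∀ e ∈ E, SupIrred e ∧ DRelL a e ∧ (e ≤ x ∨ e ≤ y)) ∧
      (∀ u, (∀ e ∈ E, e ≤ u) → a ≤ u) ∧ E.Nontrivial := by
    intro a x y
    by_cases h : SupIrred a ∧ a ≤ x ⊔ y ∧ ¬ a ≤ x ∧ ¬ a ≤ y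
    · obtain ⟨E, hE⟩ := FLB.cover a x y h.1 h.2.1 h.2.2.1 h.2.2.2
      exact ⟨E, fun _ => hE⟩
    · exact ⟨∅, fun h' => absurd h' h⟩
  choose E hE using hcov
  obtain ⟨ht, hht⟩ := FLB.height hL
  let cond : L → L → L → Prop := fun a x y => SupIrred a ∧ a ≤ x ⊔ y ∧ ¬ a ≤ x ∧ ¬ a ≤ y
  let A := L × L × L
  let R : A → A → Prop := fun q r => cond r.2.2 q.1 q.2.1 ∧ q.2.2 ∈ E r.2.2 q.1 q.2.1
  let valid : A × List A → Prop := fun p => List.IsChain R (p.1 :: p.2) ∧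
    ∀ q ∈ p.1 :: p.2, SupIrred q.2.2
  obtain ⟨H, hH⟩ : ∃ H, ∀ a, ht a ≤ H :=
    ⟨Finset.univ.sup ht, fun t => Finset.le_sup (Finset.mem_univ t)⟩
  have hlen : ∀ (l : List A) (q : A), valid (q, l) → l.length + ht q.2.2 ≤ H := by
    intro l
    induction l with
    | nil => intro q _; simpa using hH _
    | cons r l ih =>
      intro q hq
      obtain ⟨hq1, hq2⟩ := hq
      rw [List.isChain_cons_cons] at hq1
      have h1 := ih r ⟨hq1.2, fun s hs => hq2 s (List.mem_cons_of_mem _ hs)⟩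
      have h2 := ((hE _ _ _ hq1.1.1).1 _ hq1.1.2)
      have : ht q.2.2 < ht r.2.2 := hht _ _ ⟨hq1.1.1.1, h2.1, h2.2.1⟩
      simp only [List.length_cons]
      omega
  have hfin : {p | valid p}.Finite := by
    refine Set.Finite.subset (Set.Finite.prod (Set.finite_univ (α := A))
      (List.finite_length_le A H)) ?_
    rintro ⟨q, l⟩ h
    have := hlen l q h
    exact ⟨trivial, show l.length ≤ H by omega⟩
  let T := {p : A × List A // valid p}
  haveI : Finite T := hfin.to_subtype
  letI : Fintype T := Fintype.ofFinite T
  let lab : T → L := fun t => t.1.1.2.2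
  have hlab : ∀ t : T, SupIrred (lab t) := fun t => t.2.2 _ (List.mem_cons_self)
  let B := {b : T × L × L // cond (lab b.1) b.2.1 b.2.2}
  letI : Fintype B := Fintype.ofFinite B
  let top : B → T := fun b => b.1.1
  let blk : B → Finset T := fun b =>
    Finset.univ.filter fun s => s.1 = ((b.1.2.1, b.1.2.2, lab s), b.1.1.1.1 :: b.1.1.1.2)
  let rk : T → ℕ := fun t => t.1.2.length
  have hblk : ∀ b s, s ∈ blk b ↔ s.1 = ((b.1.2.1, b.1.2.2, lab s), b.1.1.1.1 :: b.1.1.1.2) :=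
    fun b s => by simp [blk]
  have hmem : ∀ (b : B) (s : T), s ∈ blk b → lab s ∈ E (lab (top b)) b.1.2.1 b.1.2.2 := by
    intro b s hs
    rw [hblk] at hs
    have h1 := s.2.1
    rw [hs] at h1
    exact (List.isChain_cons_cons.1 h1).1.2
  have hchild : ∀ (b : B), ∀ e ∈ E (lab (top b)) b.1.2.1 b.1.2.2, ∃ s ∈ blk b, lab s = e := by
    intro b e he
    refine ⟨⟨((b.1.2.1, b.1.2.2, e), b.1.1.1.1 :: b.1.1.1.2), ?_, ?_⟩, ?_, rfl⟩
    · exact List.isChain_cons_cons.2 ⟨⟨b.2, he⟩, b.1.1.2.1⟩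
    · intro q hq
      rcases List.mem_cons.1 hq with h | h
      · rw [h]; exact ((hE _ _ _ b.2).1 e he).1
      · exact b.1.1.2.2 q h
    · rw [hblk]
  have h1 : ∀ t b b', t ∈ blk b → t ∈ blk b' → b = b' := by
    intro t b b' hb hb'
    rw [hblk] at hb hb'
    rw [hb] at hb'
    simp only [Prod.mk.injEq, List.cons.injEq, and_true] at hb'
    apply Subtype.ext
    refine Prod.ext (Subtype.ext (Prod.ext hb'.2.1 hb'.2.2)) (Prod.ext hb'.1.1 hb'.1.2)
  have h2 : ∀ b, ∀ t ∈ blk b, rk (top b) < rk t := by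
    intro b t ht
    rw [hblk] at ht
    simp only [rk, top]
    rw [ht]
    simp
  have h3 : ∀ b, (blk b).Nontrivial := by
    intro b
    obtain ⟨e, he, e', he', hne⟩ := (hE _ _ _ b.2).2.2
    obtain ⟨s, hs, hse⟩ := hchild b e he
    obtain ⟨s', hs', hse'⟩ := hchild b e' he'
    exact ⟨s, hs, s', hs', fun h => hne (by rw [← hse, ← hse', h])⟩
  obtain ⟨n, pt, hinj, hp1, hp2, hp3⟩ := FLB.core top blk rk h1 h2 h3
  let S : L → Set T := fun x => {t | lab t ≤ x}
  have hS : ∀ x, FLB.Closed top blk (S x) := by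
    intro x b hb
    refine (hE _ _ _ b.2).2.1 x fun e he => ?_
    obtain ⟨s, hs, rfl⟩ := hchild b e he
    exact hb s hs
  have hSinf : ∀ a b, S (a ⊓ b) = S a ∩ S b := by
    intro a b; ext t; exact le_inf_iff
  have hSinj : ∀ a b, S a ⊆ S b → a ≤ b := by
    intro a b hab
    haveI : Nonempty L := ⟨a⟩
    letI : OrderBot L := Fintype.toOrderBot L
    obtain ⟨s, hs, hs'⟩ := exists_supIrred_decomposition a
    have hle : ∀ e ∈ s, e ≤ a := fun e he => by rw [← hs]; exact Finset.le_sup (f := id) he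
    rw [← hs]
    refine Finset.sup_le fun e he => ?_
    exact @hab ⟨((e, e, e), []), by simp, by simpa using hs' he⟩ (hle e he)
  have hrel : ∀ a, convexHull ℝ (pt '' S a) ∩ Set.range pt = pt '' S a := by
    intro a
    apply subset_antisymm
    · rintro _ ⟨h, t, rfl⟩
      exact ⟨t, hp2 _ t (hS a) h, rfl⟩
    · exact Set.subset_inter (subset_convexHull ℝ _) (Set.image_subset_range _ _)
  have hmono : ∀ a b, a ≤ b → pt '' S a ⊆ pt '' S b := fun a b hab =>
    Set.image_mono fun t (h : lab t ≤ a) => (h.trans hab : lab t ≤ b)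
  have hjoin : ∀ a b, pt '' S (a ⊔ b) ⊆ convexHull ℝ (pt '' S a ∪ pt '' S b) := by
    rintro a b _ ⟨t, ht, rfl⟩
    by_cases ha : lab t ≤ a
    · exact subset_convexHull ℝ _ (Or.inl ⟨t, ha, rfl⟩)
    by_cases hb : lab t ≤ b
    · exact subset_convexHull ℝ _ (Or.inr ⟨t, hb, rfl⟩)
    let β : B := ⟨(t, a, b), hlab t, ht, ha, hb⟩
    refine convexHull_mono ?_ (hp1 β)
    rintro _ ⟨s, hs, rfl⟩
    rcases ((hE _ _ _ β.2).1 _ (hmem β s hs)).2.2 with h | h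
    · exact Or.inl ⟨s, h, rfl⟩
    · exact Or.inr ⟨s, h, rfl⟩
  have hun : ∀ a b, pt '' S a ∪ pt '' S b ⊆ pt '' S (a ⊔ b) := fun a b =>
    Set.union_subset (hmono _ _ le_sup_left) (hmono _ _ le_sup_right)
  have hfinj : Function.Injective fun a => pt '' S a := by
    intro a b hab
    have : S a = S b := hinj.image_injective hab
    exact le_antisymm (hSinj _ _ this.le) (hSinj _ _ this.ge)
  refine ⟨n, Set.range pt, Set.finite_range pt, FLB.noCycle top blk rk h2 h3 pt hinj hp1 hp2,
    ⟨fun a => pt '' S a, hfinj, fun a => (hrel a).symm, ?_, ?_⟩,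
    ⟨fun a => convexHull ℝ (pt '' S a), ?_, fun a => convex_convexHull ℝ _, ?_, ?_⟩⟩
  · intro a b
    simp only [hSinf, Set.image_inter hinj]
  · intro a b
    apply subset_antisymm
    · exact Set.subset_inter (hjoin a b) (Set.image_subset_range _ _)
    · show convexHull ℝ (pt '' S a ∪ pt '' S b) ∩ Set.range pt ⊆ pt '' S (a ⊔ b)
      rw [← hrel (a ⊔ b)]
      exact Set.inter_subset_inter_left _ (convexHull_mono (hun a b))
  · intro a b hab
    have hab' : convexHull ℝ (pt '' S a) = convexHull ℝ (pt '' S b) := hab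
    apply hfinj
    show pt '' S a = pt '' S b
    rw [← hrel a, ← hrel b, hab']
  · intro a b
    apply subset_antisymm
    · exact Set.subset_inter (convexHull_mono (hmono _ _ inf_le_left))
        (convexHull_mono (hmono _ _ inf_le_right))
    · show _ ⊆ convexHull ℝ (pt '' S (a ⊓ b))
      rw [hSinf]
      exact hp3 _ _ (hS a) (hS b)
  · intro a b
    apply subset_antisymm
    · refine convexHull_min ((hjoin a b).trans (convexHull_mono ?_)) (convex_convexHull ℝ _)
      exact Set.union_subset_union (subset_convexHull ℝ _) (subset_convexHull ℝ _)
    · refine convexHull_min ?_ (convex_convexHull ℝ _)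
      exact Set.union_subset (convexHull_mono (hmono _ _ le_sup_left))
        (convexHull_mono (hmono _ _ le_sup_right))
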